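/- arXiv:2409.16003 — 2 statements merged into one kernel-verified Lean document; each statement's English description precedes it below -/
import Mathlib

section
/- Let d = ℓ + m, ν > 0, μ = (μ₁, μ₂) ∈ ℝ^ℓ × ℝ^m, and Σ ∈ ℝ^{d×d} positive definite with block decomposition Σ = [[Σ₁₁, Σ₁₂], [Σ₂₁, Σ₂₂]]. Then for every x₂ ∈ ℝ^m, ∫_{ℝ^ℓ} f_d((x₁, x₂); μ, Σ, ν) dx₁ = f_m(x₂; μ₂, Σ₂₂, ν). That is, the marginal of a multivariate Student t-distribution t_d(μ, Σ, ν) over a block of coordinates is the multivariate Student t-distribution t_m(μ₂, Σ₂₂, ν) with the same degrees of freedom. -/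
open MeasureTheory Matrix

/-- Multivariate Student `t` density with location `μ`, scale `Σ` and `ν` degrees of freedom. -/
noncomputable def studentPdf {ι : Type*} [Fintype ι] [DecidableEq ι]
    (μ : ι → ℝ) (S : Matrix ι ι ℝ) (ν : ℝ) (x : ι → ℝ) : ℝ :=
  Real.Gamma ((ν + Fintype.card ι) / 2) /
      (Real.Gamma (ν / 2) * (ν * Real.pi) ^ ((Fintype.card ι : ℝ) / 2) *
        S.det ^ ((1 : ℝ) / 2)) *
    (1 + ν⁻¹ * ((x - μ) ⬝ᵥ S⁻¹ *ᵥ (x - μ))) ^ (-(ν + Fintype.card ι) / 2)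

lemma integrable_exp_neg_mul_dotProduct_self {ι : Type*} [Fintype ι] {t : ℝ} (ht : 0 < t) :
    Integrable fun y : ι → ℝ => Real.exp (-t * (y ⬝ᵥ y)) := by
  have h := Integrable.fintype_prod (ι := ι) (μ := fun _ => (volume : Measure ℝ))
    (f := fun _ x => Real.exp (-t * x ^ 2)) fun _ => integrable_exp_neg_mul_sq ht
  simpa only [← Real.exp_sum, ← Finset.mul_sum, pow_two] using! h

lemma integral_exp_neg_mul_dotProduct_self {ι : Type*} [Fintype ι] {t : ℝ} (ht : 0 < t) :
    ∫ y : ι → ℝ, Real.exp (-t * (y ⬝ᵥ y)) =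
      (Real.pi / t) ^ ((Fintype.card ι : ℝ) / 2) := by
  have h := integral_fintype_prod_volume_eq_pow (ι := ι) fun x : ℝ => Real.exp (-t * x ^ 2)
  rw [integral_gaussian, Real.sqrt_eq_rpow, ← Real.rpow_natCast, ← Real.rpow_mul (by positivity),
    one_div_mul_eq_div] at h
  simpa only [← Real.exp_sum, ← Finset.mul_sum, pow_two] using! h

lemma integral_add_dotProduct_self_rpow_neg {ι : Type*} [Fintype ι] {a c : ℝ} (hc : 0 < c)
    (ha : (Fintype.card ι : ℝ) / 2 < a) :
    ∫ y : ι → ℝ, (c + y ⬝ᵥ y) ^ (-a) =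
      Real.pi ^ ((Fintype.card ι : ℝ) / 2) * Real.Gamma (a - (Fintype.card ι : ℝ) / 2) /
        Real.Gamma a * c ^ (-(a - (Fintype.card ι : ℝ) / 2)) := by
  set k : ℝ := (Fintype.card ι : ℝ) / 2 with hk
  have hk0 : 0 ≤ k := by positivity
  have ha0 : 0 < a := hk0.trans_lt ha
  have hb : 0 < a - k := sub_pos.2 ha
  have hpos (y : ι → ℝ) : 0 < c + y ⬝ᵥ y :=
    add_pos_of_pos_of_nonneg hc (Finset.sum_nonneg fun i _ => mul_self_nonneg (y i))
  let F : (ι → ℝ) → ℝ → ℝ := fun y t => t ^ (a - 1) * Real.exp (-((c + y ⬝ᵥ y) * t))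
  have hF (y : ι → ℝ) (t : ℝ) :
      F y t = t ^ (a - 1) * Real.exp (-(c * t)) * Real.exp (-t * (y ⬝ᵥ y)) := by
    simp only [F]
    rw [mul_assoc, ← Real.exp_add]
    ring_nf
  have hin {t : ℝ} (ht : 0 < t) :
      ∫ y, F y t = Real.pi ^ k * (t ^ (a - k - 1) * Real.exp (-(c * t))) := by
    simp only [hF]
    rw [integral_const_mul, integral_exp_neg_mul_dotProduct_self ht, ← hk,
      Real.div_rpow Real.pi_pos.le ht.le, show a - k - 1 = a - 1 - k by ring,
      Real.rpow_sub ht (a - 1) k]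
    ring
  have hval := Real.integral_rpow_mul_exp_neg_mul_Ioi hb hc
  have hintegral : IntegrableOn (fun t : ℝ => t ^ (a - k - 1) * Real.exp (-(c * t))) (Set.Ioi 0) :=
    .of_integral_ne_zero (by rw [hval]; have := Real.Gamma_pos_of_pos hb; positivity)
  have hFint : Integrable (Function.uncurry F)
      ((volume : Measure (ι → ℝ)).prod (volume.restrict (Set.Ioi (0 : ℝ)))) := by
    have hm : Measurable (Function.uncurry F) := by
      unfold F Function.uncurry dotProduct
      fun_prop
    refine (integrable_prod_iff' hm.aestronglyMeasurable).2 ⟨?_, ?_⟩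
    · filter_upwards [ae_restrict_mem measurableSet_Ioi] with t ht
      simp only [Function.uncurry_apply_pair, hF]
      exact (integrable_exp_neg_mul_dotProduct_self ht).const_mul _
    · refine (hintegral.const_mul (Real.pi ^ k)).congr ?_
      filter_upwards [ae_restrict_mem measurableSet_Ioi] with t (ht : 0 < t)
      rw [← hin ht]
      refine integral_congr_ae (.of_forall fun y => ?_)
      exact (Real.norm_of_nonneg (by simp only [F]; positivity)).symm
  have hswap := integral_integral_swap hFint
  have hleft : ∫ y, ∫ t in Set.Ioi 0, F y t = (∫ y : ι → ℝ, (c + y ⬝ᵥ y) ^ (-a)) * Real.Gamma a := by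
    rw [← integral_mul_const]
    refine integral_congr_ae (.of_forall fun y => ?_)
    simp only [F]
    rw [Real.integral_rpow_mul_exp_neg_mul_Ioi ha0 (hpos y), one_div, Real.inv_rpow (hpos y).le,
      Real.rpow_neg (hpos y).le]
  rw [hleft, setIntegral_congr_fun measurableSet_Ioi fun t ht => hin ht, integral_const_mul, hval,
    one_div, Real.inv_rpow hc.le, ← Real.rpow_neg hc.le] at hswap
  have := Real.Gamma_pos_of_pos ha0
  field_simp
  linear_combination hswap

open scoped MatrixOrder in
lemma Matrix.PosDef.integral_add_quadratic_rpow_neg {ι : Type*} [Fintype ι] [DecidableEq ι]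
    {A : Matrix ι ι ℝ} (hA : A.PosDef) (v : ι → ℝ) {a c : ℝ} (hc : 0 < c)
    (ha : (Fintype.card ι : ℝ) / 2 < a) :
    ∫ y : ι → ℝ, (c + (y - v) ⬝ᵥ A *ᵥ (y - v)) ^ (-a) =
      Real.pi ^ ((Fintype.card ι : ℝ) / 2) * Real.Gamma (a - (Fintype.card ι : ℝ) / 2) /
        Real.Gamma a * c ^ (-(a - (Fintype.card ι : ℝ) / 2)) * A.det ^ (-(1 / 2) : ℝ) := by
  set B := CFC.sqrt A
  have hBB : B * B = A := CFC.sqrt_mul_sqrt_self A hA.posSemidef.nonneg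
  have hB : B.PosSemidef := (CFC.sqrt_nonneg A).posSemidef
  have hBt : Bᵀ = B := hB.1
  have hdet : B.det = A.det ^ (1 / 2 : ℝ) := by
    rw [← Real.sqrt_eq_rpow, ← hBB, det_mul, Real.sqrt_mul_self hB.det_nonneg]
  have hdet0 : 0 < B.det := hdet ▸ Real.rpow_pos_of_pos hA.det_pos _
  have hq (y : ι → ℝ) : y ⬝ᵥ A *ᵥ y = toLin' B y ⬝ᵥ toLin' B y := by
    rw [toLin'_apply, ← hBB, ← mulVec_mulVec, dotProduct_mulVec, ← mulVec_transpose, hBt]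
  have hmeas : Measurable fun z : ι → ℝ => (c + z ⬝ᵥ z) ^ (-a) := by
    unfold dotProduct
    fun_prop
  rw [integral_sub_right_eq_self (fun y : ι → ℝ => (c + y ⬝ᵥ A *ᵥ y) ^ (-a)) v]
  simp only [hq]
  rw [← integral_map (φ := toLin' B) (f := fun z : ι → ℝ => (c + z ⬝ᵥ z) ^ (-a))
      (toLin' B).continuous_of_finiteDimensional.aemeasurable hmeas.aestronglyMeasurable,
    Real.map_matrix_volume_pi_eq_smul_volume_pi hdet0.ne', integral_smul_measure,
    integral_add_dotProduct_self_rpow_neg hc ha, ENNReal.toReal_ofReal (abs_nonneg _),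
    abs_of_pos (inv_pos.2 hdet0), hdet, Real.rpow_neg hA.det_pos.le, smul_eq_mul, mul_comm]

lemma Matrix.inv_fromBlocks_quadratic {m n : Type*} [Fintype m] [Fintype n] [DecidableEq m]
    [DecidableEq n] {A : Matrix m m ℝ} {B : Matrix m n ℝ} {D : Matrix n n ℝ}
    (hD : IsUnit D) (hDt : Dᵀ = D) (hS : IsUnit (A - B * D⁻¹ * Bᵀ)) (x : m → ℝ) (y : n → ℝ) :
    Sum.elim x y ⬝ᵥ (fromBlocks A B Bᵀ D)⁻¹ *ᵥ Sum.elim x y =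
      y ⬝ᵥ D⁻¹ *ᵥ y +
        (x - (B * D⁻¹) *ᵥ y) ⬝ᵥ (A - B * D⁻¹ * Bᵀ)⁻¹ *ᵥ (x - (B * D⁻¹) *ᵥ y) := by
  let := hD.invertible
  let : Invertible (A - B * ⅟D * Bᵀ) := by rw [invOf_eq_nonsing_inv]; exact hS.invertible
  let := fromBlocks₂₂Invertible A B Bᵀ D
  have hDi : (D⁻¹)ᵀ = D⁻¹ := by rw [transpose_nonsing_inv, hDt]
  have hy (w : m → ℝ) : y ⬝ᵥ (D⁻¹ * Bᵀ) *ᵥ w = (B * D⁻¹) *ᵥ y ⬝ᵥ w := by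
    rw [dotProduct_mulVec, ← mulVec_transpose, transpose_mul, transpose_transpose, hDi]
  rw [← invOf_eq_nonsing_inv (fromBlocks A B Bᵀ D), invOf_fromBlocks₂₂_eq]
  simp only [invOf_eq_nonsing_inv]
  generalize (A - B * D⁻¹ * Bᵀ)⁻¹ = T
  rw [fromBlocks_mulVec, Sum.elim_comp_inl, Sum.elim_comp_inr, sumElim_dotProduct_sumElim,
    Matrix.mul_assoc T, Matrix.mul_assoc (D⁻¹ * Bᵀ * T)]
  simp only [neg_mulVec, add_mulVec, dotProduct_add, dotProduct_neg, mulVec_sub, dotProduct_sub,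
    sub_dotProduct, ← mulVec_mulVec _ T, ← mulVec_mulVec _ (D⁻¹ * Bᵀ), hy,
    ← mulVec_mulVec _ (D⁻¹ * Bᵀ * T)]
  ring

lemma Matrix.PosDef.schurComplement₂₂ {m n : Type*} [Fintype m] [Fintype n] [DecidableEq m]
    [DecidableEq n] {A : Matrix m m ℝ} {B : Matrix m n ℝ} {D : Matrix n n ℝ}
    (h : (fromBlocks A B Bᴴ D).PosDef) (hD : D.PosDef) : (A - B * D⁻¹ * Bᴴ).PosDef := by
  let := hD.isUnit.invertible
  rw [((hD.fromBlocks₂₂ A B).1 h.posSemidef).posDef_iff_det_ne_zero]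
  have hdet := h.det_pos
  rw [det_fromBlocks₂₂, invOf_eq_nonsing_inv] at hdet
  exact right_ne_zero_of_mul hdet.ne'

/-- **Marginals of the multivariate Student t-distribution.**  For a positive definite block
matrix `Σ = [[Σ₁₁, Σ₁₂], [Σ₂₁, Σ₂₂]]` and `μ = (μ₁, μ₂)`, integrating the `t_d(μ, Σ, ν)`
density over the first `ℓ` coordinates yields the `t_m(μ₂, Σ₂₂, ν)` density: the marginal of a
multivariate Student t-distribution is Student t with the same degrees of freedom. -/
theorem stmt_8 {l m : ℕ} (ν : ℝ) (hν : 0 < ν)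
    (μ₁ : Fin l → ℝ) (μ₂ : Fin m → ℝ)
    (S11 : Matrix (Fin l) (Fin l) ℝ) (S12 : Matrix (Fin l) (Fin m) ℝ)
    (S21 : Matrix (Fin m) (Fin l) ℝ) (S22 : Matrix (Fin m) (Fin m) ℝ)
    (hS : (Matrix.fromBlocks S11 S12 S21 S22).PosDef) :
    ∀ x₂ : Fin m → ℝ,
      (∫ x₁ : Fin l → ℝ,
        studentPdf (Sum.elim μ₁ μ₂) (Matrix.fromBlocks S11 S12 S21 S22) ν
          (Sum.elim x₁ x₂)) = studentPdf μ₂ S22 ν x₂ := by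
  intro x₂
  have hD : S22.PosDef := hS.submatrix Sum.inr_injective
  obtain ⟨-, rfl, -, hDt⟩ := isHermitian_fromBlocks_iff.1 hS.isHermitian
  have hC : (S11 - S12 * S22⁻¹ * S12ᵀ).PosDef := hS.schurComplement₂₂ hD
  have hdet : (fromBlocks S11 S12 S12ᵀ S22).det =
      S22.det * (S11 - S12 * S22⁻¹ * S12ᵀ).det := by
    let := hD.isUnit.invertible
    rw [det_fromBlocks₂₂, invOf_eq_nonsing_inv]
  set C := S11 - S12 * S22⁻¹ * S12ᵀ with hCdef
  set q : ℝ := (x₂ - μ₂) ⬝ᵥ S22⁻¹ *ᵥ (x₂ - μ₂) with hq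
  have hc : 0 < 1 + ν⁻¹ * q :=
    add_pos_of_pos_of_nonneg one_pos
      (mul_nonneg (inv_nonneg.2 hν.le) (hD.inv.posSemidef.dotProduct_mulVec_nonneg (x₂ - μ₂)))
  have hquad (x₁ : Fin l → ℝ) :
      1 + ν⁻¹ * ((Sum.elim x₁ x₂ - Sum.elim μ₁ μ₂) ⬝ᵥ
        (fromBlocks S11 S12 S12ᵀ S22)⁻¹ *ᵥ (Sum.elim x₁ x₂ - Sum.elim μ₁ μ₂)) =
      (1 + ν⁻¹ * q) + (x₁ - (μ₁ + (S12 * S22⁻¹) *ᵥ (x₂ - μ₂))) ⬝ᵥ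
        (ν⁻¹ • C⁻¹) *ᵥ (x₁ - (μ₁ + (S12 * S22⁻¹) *ᵥ (x₂ - μ₂))) := by
    rw [← Sum.elim_sub_sub, inv_fromBlocks_quadratic hD.isUnit hDt hC.isUnit, ← hCdef, ← hq,
      sub_sub, smul_mulVec, dotProduct_smul, smul_eq_mul]
    ring
  have hl : 0 ≤ (l : ℝ) := l.cast_nonneg
  have hm : 0 ≤ (m : ℝ) := m.cast_nonneg
  have hintegral := (hC.inv.smul (inv_pos.2 hν)).integral_add_quadratic_rpow_neg
    (μ₁ + (S12 * S22⁻¹) *ᵥ (x₂ - μ₂)) (a := (ν + (l + m)) / 2) hc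
    (by rw [Fintype.card_fin]; linarith)
  rw [Fintype.card_fin, show (ν + (l + m)) / 2 - (l : ℝ) / 2 = (ν + m) / 2 by ring, det_smul,
    Fintype.card_fin, det_nonsing_inv, Ring.inverse_eq_inv'] at hintegral
  simp only [studentPdf, conjTranspose_eq_transpose_of_trivial, Fintype.card_sum, Fintype.card_fin,
    Nat.cast_add, hquad, neg_div]
  rw [integral_const_mul, hintegral, hdet, ← hq]
  have hGa : 0 < Real.Gamma ((ν + (l + m)) / 2) := Real.Gamma_pos_of_pos (by positivity)
  have hGν : 0 < Real.Gamma (ν / 2) := Real.Gamma_pos_of_pos (by positivity)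
  have hCd : 0 < C.det ^ (1 / 2 : ℝ) := Real.rpow_pos_of_pos hC.det_pos _
  have hDd : 0 < S22.det ^ (1 / 2 : ℝ) := Real.rpow_pos_of_pos hD.det_pos _
  have hscale : (ν⁻¹ ^ l * C.det⁻¹) ^ (-(1 / 2) : ℝ) = ν ^ ((l : ℝ) / 2) * C.det ^ (1 / 2 : ℝ) := by
    rw [inv_pow, ← mul_inv, Real.rpow_neg (inv_nonneg.2 (mul_pos (pow_pos hν l) hC.det_pos).le),
      Real.inv_rpow (mul_pos (pow_pos hν l) hC.det_pos).le, inv_inv,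
      Real.mul_rpow (pow_pos hν l).le hC.det_pos.le, ← Real.rpow_natCast, ← Real.rpow_mul hν.le,
      mul_one_div]
  rw [hscale, Real.mul_rpow hD.det_pos.le hC.det_pos.le, add_div (l : ℝ),
    Real.rpow_add (by positivity), Real.mul_rpow hν.le Real.pi_pos.le (z := (l : ℝ) / 2)]
  field_simp
end

section
/- Let p, d ≥ 1, γ ∈ ℝ^p, and let Ω* = [[Γ, Δᵗ], [Δ, Ω̄]] ∈ ℝ^{(p+d)×(p+d)} be a positive definite matrix partitioned so that Γ ∈ ℝ^{p×p}, Δ ∈ ℝ^{d×p}... (with Δᵗ ∈ ℝ^{p×d} and Ω̄ ∈ ℝ^{d×d}), where Ω̄ is a correlation matrix. Let U = (U₀, U₁) ~ N_{p+d}(0, Ω*), let Z be a random vector distributed as the conditional law of U₁ given the componentwise event {U₀ + γ > 0}, and set Y = ξ + ωZ with ξ ∈ ℝ^d and ω = diag(ω₁, …, ω_d) with ωᵢ > 0. Then Y has density f_Y(x) = φ_d(x − ξ; Ω) · Φ_p(γ + Δᵗ Ω̄⁻¹ ω⁻¹ (x − ξ); Γ − Δᵗ Ω̄⁻¹ Δ)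 / Φ_p(γ; Γ) for x ∈ ℝ^d, where Ω = ω Ω̄ ω. (This Y is said to follow the multivariate unified skew-normal distribution SUN_{d,p}(ξ, γ, ω1_d, Ω*).) -/
open MeasureTheory Matrix ProbabilityTheory

/-- Multivariate Gaussian density `φ(x; Σ)` (centered) on `ι → ℝ`. -/
noncomputable def gaussPdf {ι : Type*} [Fintype ι] [DecidableEq ι]
    (μ : ι → ℝ) (S : Matrix ι ι ℝ) (x : ι → ℝ) : ℝ :=
  (2 * Real.pi) ^ (-(Fintype.card ι : ℝ) / 2) * S.det ^ (-(1 : ℝ) / 2) *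
    Real.exp (-(1 / 2) * ((x - μ) ⬝ᵥ S⁻¹ *ᵥ (x - μ)))

/-- Centered multivariate Gaussian cumulative distribution function `Φ(t; Σ)`. -/
noncomputable def gaussCdf {ι : Type*} [Fintype ι] [DecidableEq ι]
    (S : Matrix ι ι ℝ) (t : ι → ℝ) : ℝ :=
  ∫ x in Set.Iic t, gaussPdf 0 S x

/-- Density of the multivariate unified skew-normal distribution
`SUN(ξ, γ, ω1, Ω* = [[Γ, Δᵀ], [Δ, Ω̄]])`, with `ω = diagonal w` and `Ω = ωΩ̄ω`:
`f(x) = φ(x − ξ; Ω) Φ(γ + Δᵀ Ω̄⁻¹ ω⁻¹ (x − ξ); Γ − Δᵀ Ω̄⁻¹ Δ) / Φ(γ; Γ)`. -/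
noncomputable def sunPdf {ι κ : Type*} [Fintype ι] [Fintype κ] [DecidableEq ι] [DecidableEq κ]
    (ξ : ι → ℝ) (γ : κ → ℝ) (w : ι → ℝ) (Γ : Matrix κ κ ℝ) (Δ : Matrix ι κ ℝ)
    (Ωb : Matrix ι ι ℝ) (x : ι → ℝ) : ℝ :=
  gaussPdf 0 (Matrix.diagonal w * Ωb * Matrix.diagonal w) (x - ξ) *
      gaussCdf (Γ - Δᵀ * Ωb⁻¹ * Δ) (γ + Δᵀ *ᵥ Ωb⁻¹ *ᵥ fun i => (x i - ξ i) / w i) /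
    gaussCdf Γ γ

lemma posDef_fromBlocks_swap {ι κ : Type*} {A : Matrix κ κ ℝ} {C : Matrix ι κ ℝ}
    {D : Matrix ι ι ℝ} (h : (fromBlocks A Cᵀ C D).PosDef) : (fromBlocks D Cᵀᵀ Cᵀ A).PosDef := by
  simpa using h.submatrix Sum.swap_leftInverse.injective

lemma posDef_of_fromBlocks_right {ι κ : Type*} {A : Matrix κ κ ℝ} {C : Matrix ι κ ℝ}
    {D : Matrix ι ι ℝ} (h : (fromBlocks A Cᵀ C D).PosDef) : D.PosDef :=
  h.submatrix Sum.inr_injective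

lemma lintegral_sum_pi {ι κ : Type*} [Fintype ι] [Fintype κ]
    {f : (κ ⊕ ι → ℝ) → ENNReal} (hf : Measurable f) :
    ∫⁻ x, f x = ∫⁻ b : ι → ℝ, ∫⁻ a : κ → ℝ, f (Sum.elim a b) := by
  have h := (volume_measurePreserving_sumPiEquivProdPi_symm fun _ : κ ⊕ ι => ℝ)
  have he (z : (κ → ℝ) × (ι → ℝ)) :
      (MeasurableEquiv.sumPiEquivProdPi fun _ : κ ⊕ ι => ℝ).symm z = Sum.elim z.1 z.2 := by
    ext i
    cases i <;> rfl
  have hm : Measurable fun z : (κ → ℝ) × (ι → ℝ) => f (Sum.elim z.1 z.2) := by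
    simp_rw [← he]
    exact hf.comp (MeasurableEquiv.measurable _)
  rw [← h.lintegral_comp hf]
  simp_rw [he]
  rw [Measure.volume_eq_prod, lintegral_prod_symm' _ hm]

section GaussPdf

variable {ι κ : Type*} [Fintype ι] [DecidableEq ι] [Fintype κ] [DecidableEq κ]

lemma gaussPdf_pos {S : Matrix ι ι ℝ} (hS : S.PosDef) (m x : ι → ℝ) : 0 < gaussPdf m S x := by
  have := hS.det_pos
  unfold gaussPdf
  positivity

lemma continuous_gaussPdf (m : ι → ℝ) (S : Matrix ι ι ℝ) : Continuous (gaussPdf m S) := by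
  unfold gaussPdf
  fun_prop

lemma measurable_ofReal_gaussPdf (S : Matrix ι ι ℝ) :
    Measurable fun x => ENNReal.ofReal (gaussPdf 0 S x) :=
  (continuous_gaussPdf 0 S).measurable.ennreal_ofReal

lemma gaussPdf_zero_neg (S : Matrix ι ι ℝ) (x : ι → ℝ) : gaussPdf 0 S (-x) = gaussPdf 0 S x := by
  simp [gaussPdf, mulVec_neg]

/-- Transformation of the centered Gaussian density under an invertible linear map. -/
lemma gaussPdf_congruence {S M : Matrix ι ι ℝ} (hS : S.PosDef) (hM : M.det ≠ 0) (z : ι → ℝ) :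
    gaussPdf 0 (M * S * Mᵀ) (M *ᵥ z) = |M.det|⁻¹ * gaussPdf 0 S z := by
  have hdet : (M * S * Mᵀ).det ^ (-(1 : ℝ) / 2) = |M.det|⁻¹ * S.det ^ (-(1 : ℝ) / 2) := by
    have h : (M * S * Mᵀ).det = |M.det| ^ 2 * S.det := by
      rw [det_mul, det_mul, det_transpose, sq_abs]
      ring
    rw [h, Real.mul_rpow (by positivity) hS.det_pos.le, ← Real.rpow_natCast,
      ← Real.rpow_mul (abs_nonneg _), ← Real.rpow_neg_one]
    norm_num
  have hquad : (M *ᵥ z) ⬝ᵥ (M * S * Mᵀ)⁻¹ *ᵥ (M *ᵥ z) = z ⬝ᵥ S⁻¹ *ᵥ z := by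
    have hu : IsUnit M.det := hM.isUnit
    have hut : IsUnit Mᵀ.det := by rwa [det_transpose]
    rw [Matrix.mul_inv_rev, Matrix.mul_inv_rev, dotProduct_comm, dotProduct_mulVec,
      ← mulVec_transpose, dotProduct_comm, mulVec_mulVec, mulVec_mulVec,
      Matrix.mul_nonsing_inv_cancel_left _ _ hut, Matrix.nonsing_inv_mul_cancel_right _ _ hu]
  simp only [gaussPdf, sub_zero, hdet, hquad]
  ring

lemma lintegral_comp_mulVec {M : Matrix ι ι ℝ} (hM : M.det ≠ 0) (f : (ι → ℝ) → ENNReal) :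
    ∫⁻ z, f (M *ᵥ z) = ENNReal.ofReal |M.det|⁻¹ * ∫⁻ x, f x := by
  have hme : MeasurableEmbedding (toLin' M) :=
    ((LinearMap.continuous_of_finiteDimensional _).measurableEmbedding
      (mulVec_injective_of_isUnit ((isUnit_iff_isUnit_det M).2 hM.isUnit)))
  rw [← abs_inv, ← smul_eq_mul, ← lintegral_smul_measure,
    ← Real.map_matrix_volume_pi_eq_smul_volume_pi hM, hme.lintegral_map]
  simp

lemma gaussPdf_zero_one (x : ι → ℝ) : gaussPdf 0 1 x = ∏ i, gaussianPDFReal 0 1 (x i) := by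
  have hc : (2 * Real.pi) ^ (-(Fintype.card ι : ℝ) / 2) = ∏ _i : ι, (√(2 * Real.pi))⁻¹ := by
    rw [Finset.prod_const, Finset.card_univ, Real.sqrt_eq_rpow, ← Real.rpow_neg (by positivity),
      ← Real.rpow_natCast, ← Real.rpow_mul (by positivity)]
    congr 1
    ring
  simp only [gaussPdf, gaussianPDFReal, Finset.prod_mul_distrib, ← Real.exp_sum, hc, det_one,
    Real.one_rpow, inv_one, one_mulVec, sub_zero, NNReal.coe_one, mul_one]
  congr 2
  rw [dotProduct, Finset.mul_sum]
  exact Finset.sum_congr rfl fun i _ => by ring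

lemma lintegral_gaussPdf_zero_one : ∫⁻ x : ι → ℝ, ENNReal.ofReal (gaussPdf 0 1 x) = 1 := by
  have hint : Integrable fun x : ι → ℝ => ∏ i, gaussianPDFReal 0 1 (x i) :=
    Integrable.fintype_prod fun _ => integrable_gaussianPDFReal 0 1
  simp_rw [gaussPdf_zero_one]
  rw [← ofReal_integral_eq_lintegral_ofReal hint
    (.of_forall fun x => Finset.prod_nonneg fun i _ => gaussianPDFReal_nonneg _ _ _),
    integral_fintype_prod_volume_eq_prod (fun _ : ι => gaussianPDFReal 0 1)]
  simp [integral_gaussianPDFReal_eq_one]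

open scoped MatrixOrder in
lemma lintegral_gaussPdf {S : Matrix ι ι ℝ} (hS : S.PosDef) :
    ∫⁻ x, ENNReal.ofReal (gaussPdf 0 S x) = 1 := by
  obtain ⟨M, hM⟩ : ∃ M : Matrix ι ι ℝ, S = M * Mᵀ := by
    obtain ⟨B, hB⟩ := CStarAlgebra.nonneg_iff_eq_star_mul_self.mp hS.posSemidef.nonneg
    exact ⟨Bᵀ, by simpa [star_eq_conjTranspose] using hB⟩
  have hdet : M.det ≠ 0 := by
    have := hS.det_pos.ne'
    rw [hM, det_mul] at this
    exact left_ne_zero_of_mul this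
  have h := lintegral_comp_mulVec hdet fun x => ENNReal.ofReal (gaussPdf 0 S x)
  have hpos : 0 < |M.det|⁻¹ := by positivity
  have hg (z : ι → ℝ) : gaussPdf 0 S (M *ᵥ z) = |M.det|⁻¹ * gaussPdf 0 1 z := by
    rw [← gaussPdf_congruence PosDef.one hdet, Matrix.mul_one, hM]
  simp_rw [hg, ENNReal.ofReal_mul hpos.le] at h
  rw [lintegral_const_mul _ (measurable_ofReal_gaussPdf 1), lintegral_gaussPdf_zero_one] at h
  exact ((ENNReal.mul_right_inj (by simpa using hdet) ENNReal.ofReal_ne_top).mp h).symm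

lemma integrable_gaussPdf {S : Matrix ι ι ℝ} (hS : S.PosDef) : Integrable (gaussPdf 0 S) := by
  refine ⟨(continuous_gaussPdf 0 S).aestronglyMeasurable, ?_⟩
  rw [hasFiniteIntegral_iff_ofReal (.of_forall fun x => (gaussPdf_pos hS 0 x).le),
    lintegral_gaussPdf hS]
  exact ENNReal.one_lt_top

lemma ofReal_gaussCdf {S : Matrix ι ι ℝ} (hS : S.PosDef) (t : ι → ℝ) :
    ENNReal.ofReal (gaussCdf S t) = ∫⁻ x in Set.Iic t, ENNReal.ofReal (gaussPdf 0 S x) :=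
  ofReal_integral_eq_lintegral_ofReal (integrable_gaussPdf hS).integrableOn
    (.of_forall fun x => (gaussPdf_pos hS 0 x).le)

lemma gaussCdf_pos {S : Matrix ι ι ℝ} (hS : S.PosDef) (t : ι → ℝ) : 0 < gaussCdf S t := by
  refine (setIntegral_pos_iff_support_of_nonneg_ae
    (.of_forall fun x => (gaussPdf_pos hS 0 x).le) (integrable_gaussPdf hS).integrableOn).2 ?_
  have hsupp : Function.support (gaussPdf 0 S) = Set.univ :=
    Set.eq_univ_of_forall fun x => (gaussPdf_pos hS 0 x).ne'
  have hne : (Set.univ.pi fun i => Set.Iio (t i)).Nonempty :=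
    Set.univ_pi_nonempty_iff.2 fun i => Set.nonempty_Iio
  rw [hsupp, Set.univ_inter, volume_pi, ← measure_congr Measure.univ_pi_Iio_ae_eq_Iic,
    ← volume_pi]
  exact (isOpen_set_pi Set.finite_univ fun _ _ => isOpen_Iio).measure_pos _ hne

/-- The upper orthant probability of a shifted centered Gaussian density is its distribution
function. -/
lemma setLIntegral_gaussPdf_sub {S : Matrix ι ι ℝ} (hS : S.PosDef) (γ c : ι → ℝ) :
    ∫⁻ a in {a | ∀ j, 0 < a j + γ j}, ENNReal.ofReal (gaussPdf 0 S (a - c)) =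
      ENNReal.ofReal (gaussCdf S (γ + c)) := by
  have hmeas : MeasurableSet {a : ι → ℝ | ∀ j, 0 < a j + γ j} := by measurability
  have hmeas' : MeasurableSet (Set.univ.pi fun i => Set.Iio ((γ + c) i)) :=
    MeasurableSet.univ_pi fun _ => measurableSet_Iio
  rw [ofReal_gaussCdf hS, volume_pi, ← setLIntegral_congr Measure.univ_pi_Iio_ae_eq_Iic,
    ← volume_pi, ← lintegral_indicator hmeas, ← lintegral_indicator hmeas',
    ← lintegral_sub_left_eq_self _ c]
  refine lintegral_congr fun a => ?_
  have hiff : c - a ∈ {a : ι → ℝ | ∀ j, 0 < a j + γ j} ↔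
      a ∈ Set.univ.pi fun i => Set.Iio ((γ + c) i) := by
    simp only [Set.mem_univ_pi, Set.mem_Iio, Pi.sub_apply, Pi.add_apply, Set.mem_ofPred_eq]
    exact forall_congr' fun j => ⟨fun h => by linarith, fun h => by linarith⟩
  by_cases ha : a ∈ Set.univ.pi fun i => Set.Iio ((γ + c) i)
  · rw [Set.indicator_of_mem (hiff.2 ha), Set.indicator_of_mem ha, sub_sub_cancel_left,
      gaussPdf_zero_neg]
  · rw [Set.indicator_of_notMem (mt hiff.1 ha), Set.indicator_of_notMem ha]

lemma gaussPdf_submatrix (e : κ ≃ ι) (S : Matrix ι ι ℝ) (x : ι → ℝ) :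
    gaussPdf 0 (S.submatrix e e) (x ∘ e) = gaussPdf 0 S x := by
  have hquad : (x ∘ e) ⬝ᵥ (S.submatrix e e)⁻¹ *ᵥ (x ∘ e) = x ⬝ᵥ S⁻¹ *ᵥ x := by
    rw [inv_submatrix_equiv, submatrix_mulVec_equiv, Function.comp_assoc, Equiv.self_comp_symm,
      Function.comp_id, comp_equiv_dotProduct_comp_equiv]
  simp only [gaussPdf, sub_zero, det_submatrix_equiv_self, Fintype.card_congr e, hquad]

lemma gaussPdf_fromBlocks_zero {A : Matrix κ κ ℝ} {D : Matrix ι ι ℝ} (hA : A.PosDef)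
    (hD : D.PosDef) (a : κ → ℝ) (b : ι → ℝ) :
    gaussPdf 0 (fromBlocks A 0 0 D) (Sum.elim a b) = gaussPdf 0 A a * gaussPdf 0 D b := by
  have hinv : (fromBlocks A 0 0 D)⁻¹ = fromBlocks A⁻¹ 0 0 D⁻¹ := by
    rw [inv_fromBlocks_zero₂₁_of_isUnit_iff _ _ _ (by simp [hA.isUnit, hD.isUnit])]
    simp
  simp only [gaussPdf, sub_zero, hinv, fromBlocks_mulVec, det_fromBlocks_zero₂₁,
    Fintype.card_sum, Sum.elim_comp_inl, Sum.elim_comp_inr, zero_mulVec, add_zero, zero_add,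
    sumElim_dotProduct_sumElim, mul_add, Real.exp_add, Nat.cast_add,
    Real.mul_rpow hA.det_pos.le hD.det_pos.le, neg_add, add_div,
    Real.rpow_add Real.two_pi_pos]
  ring

variable {A : Matrix κ κ ℝ} {C : Matrix ι κ ℝ} {D : Matrix ι ι ℝ}

lemma fromBlocks_eq_mul_schur (hD : D.PosDef) :
    fromBlocks A Cᵀ C D = fromBlocks 1 (Cᵀ * D⁻¹) 0 1 *
      fromBlocks (A - Cᵀ * D⁻¹ * C) 0 0 D * (fromBlocks 1 (Cᵀ * D⁻¹) 0 1)ᵀ := by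
  have hu : IsUnit D.det := hD.det_pos.ne'.isUnit
  have ht : Dᵀ = D := by simpa using hD.isHermitian.eq
  simp [fromBlocks_multiply, fromBlocks_transpose, transpose_nonsing_inv, ht, Matrix.mul_assoc,
    Matrix.nonsing_inv_mul _ hu, Matrix.mul_nonsing_inv_cancel_left _ _ hu]

lemma posDef_schur_diagonal (h : (fromBlocks A Cᵀ C D).PosDef) :
    (fromBlocks (A - Cᵀ * D⁻¹ * C) 0 0 D).PosDef := by
  have hu : IsUnit (fromBlocks 1 (Cᵀ * D⁻¹) 0 1 : Matrix (κ ⊕ ι) (κ ⊕ ι) ℝ) := by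
    simp [isUnit_iff_isUnit_det]
  rw [fromBlocks_eq_mul_schur (posDef_of_fromBlocks_right h)] at h
  exact hu.posDef_star_right_conjugate_iff.1 h

lemma posDef_schur (h : (fromBlocks A Cᵀ C D).PosDef) : (A - Cᵀ * D⁻¹ * C).PosDef :=
  (posDef_schur_diagonal h).submatrix Sum.inl_injective

/-- Factorization of a joint Gaussian density into a marginal and a conditional density. -/
lemma gaussPdf_fromBlocks (h : (fromBlocks A Cᵀ C D).PosDef) (a : κ → ℝ) (b : ι → ℝ) :
    gaussPdf 0 (fromBlocks A Cᵀ C D) (Sum.elim a b) =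
      gaussPdf 0 (A - Cᵀ * D⁻¹ * C) (a - Cᵀ *ᵥ D⁻¹ *ᵥ b) * gaussPdf 0 D b := by
  have hD := posDef_of_fromBlocks_right h
  have hS := posDef_schur h
  have hdet : (fromBlocks 1 (Cᵀ * D⁻¹) 0 1 : Matrix (κ ⊕ ι) (κ ⊕ ι) ℝ).det = 1 := by simp
  have hx : Sum.elim a b =
      fromBlocks 1 (Cᵀ * D⁻¹) 0 1 *ᵥ Sum.elim (a - Cᵀ *ᵥ D⁻¹ *ᵥ b) b := by
    simp [fromBlocks_mulVec]
  rw [fromBlocks_eq_mul_schur hD, hx, gaussPdf_congruence (posDef_schur_diagonal h) (by simp [hdet]),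
    hdet, gaussPdf_fromBlocks_zero hS hD]
  simp

/-- Mass that a joint Gaussian density gives to an orthant in the first block and a measurable set
in the second block. -/
lemma setLIntegral_gaussPdf_fromBlocks (h : (fromBlocks A Cᵀ C D).PosDef) (γ : κ → ℝ)
    {T : Set (ι → ℝ)} (hT : MeasurableSet T) :
    ∫⁻ x in {x | (∀ j, 0 < x (Sum.inl j) + γ j) ∧ x ∘ Sum.inr ∈ T},
        ENNReal.ofReal (gaussPdf 0 (fromBlocks A Cᵀ C D) x) =
      ∫⁻ b in T, ENNReal.ofReal
        (gaussPdf 0 D b * gaussCdf (A - Cᵀ * D⁻¹ * C) (γ + Cᵀ *ᵥ D⁻¹ *ᵥ b)) := by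
  have hS := posDef_schur h
  have hD := posDef_of_fromBlocks_right h
  have hE : MeasurableSet {a : κ → ℝ | ∀ j, 0 < a j + γ j} := by measurability
  have hc : Measurable fun x : κ ⊕ ι → ℝ => x ∘ Sum.inr := by unfold Function.comp; fun_prop
  have hc' : Measurable fun x : κ ⊕ ι → ℝ => x ∘ Sum.inl := by unfold Function.comp; fun_prop
  have hET : MeasurableSet {x : κ ⊕ ι → ℝ | (∀ j, 0 < x (Sum.inl j) + γ j) ∧ x ∘ Sum.inr ∈ T} :=
    (hc' hE).inter (hc hT)
  rw [← lintegral_indicator hET,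
    lintegral_sum_pi ((measurable_ofReal_gaussPdf _).indicator hET), ← lintegral_indicator hT]
  refine lintegral_congr fun b => ?_
  by_cases hb : b ∈ T
  · rw [Set.indicator_of_mem hb, ENNReal.ofReal_mul (gaussPdf_pos hD 0 b).le,
      ← setLIntegral_gaussPdf_sub hS, ← lintegral_const_mul' _ _ ENNReal.ofReal_ne_top,
      ← lintegral_indicator hE]
    refine lintegral_congr fun a => ?_
    simp only [Set.indicator, Set.mem_ofPred_eq, Sum.elim_inl, Sum.elim_comp_inr, hb, and_true]
    rw [gaussPdf_fromBlocks h, mul_comm, ENNReal.ofReal_mul (gaussPdf_pos hD 0 b).le]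
  · simp [hb]

/-- Orthant probabilities of the first block of a joint Gaussian density. -/
lemma setLIntegral_gaussPdf_fromBlocks_left (h : (fromBlocks A Cᵀ C D).PosDef) (γ : κ → ℝ) :
    ∫⁻ x in {x | ∀ j, 0 < x (Sum.inl j) + γ j},
        ENNReal.ofReal (gaussPdf 0 (fromBlocks A Cᵀ C D) x) = ENNReal.ofReal (gaussCdf A γ) := by
  have h' := posDef_fromBlocks_swap h
  have hA : A.PosDef := posDef_of_fromBlocks_right h'
  have hE : MeasurableSet {a : κ → ℝ | ∀ j, 0 < a j + γ j} := by measurability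
  have hE' : MeasurableSet {x : κ ⊕ ι → ℝ | ∀ j, 0 < x (Sum.inl j) + γ j} := by measurability
  have hfac (a : κ → ℝ) (b : ι → ℝ) : gaussPdf 0 (fromBlocks A Cᵀ C D) (Sum.elim a b) =
      gaussPdf 0 (D - Cᵀᵀ * A⁻¹ * Cᵀ) (b - Cᵀᵀ *ᵥ A⁻¹ *ᵥ a) * gaussPdf 0 A a := by
    rw [← gaussPdf_fromBlocks h', ← gaussPdf_submatrix (Equiv.sumComm ι κ)]
    congr 1
    · ext i j
      cases i <;> cases j <;> rfl
    · ext i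
      cases i <;> rfl
  have hm := (measurable_ofReal_gaussPdf (fromBlocks A Cᵀ C D)).indicator hE'
  have hm' : Measurable (Function.uncurry fun (b : ι → ℝ) (a : κ → ℝ) =>
      {x : κ ⊕ ι → ℝ | ∀ j, 0 < x (Sum.inl j) + γ j}.indicator
        (fun x => ENNReal.ofReal (gaussPdf 0 (fromBlocks A Cᵀ C D) x)) (Sum.elim a b)) := by
    refine hm.comp (measurable_pi_iff.2 fun i => ?_)
    cases i
    · exact (measurable_pi_apply _).comp measurable_snd
    · exact (measurable_pi_apply _).comp measurable_fst
  rw [← lintegral_indicator hE', lintegral_sum_pi hm, lintegral_lintegral_swap hm'.aemeasurable]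
  rw [← add_zero γ, ← setLIntegral_gaussPdf_sub hA γ 0, ← lintegral_indicator (by simpa using hE)]
  refine lintegral_congr fun a => ?_
  simp only [Set.indicator, Set.mem_ofPred_eq, Sum.elim_inl, add_zero, sub_zero]
  split_ifs
  · simp_rw [hfac, mul_comm _ (gaussPdf 0 A a), ENNReal.ofReal_mul (gaussPdf_pos hA 0 a).le]
    rw [lintegral_const_mul' _ _ ENNReal.ofReal_ne_top,
      lintegral_sub_right_eq_self
        (fun b => ENNReal.ofReal (gaussPdf 0 (D - Cᵀᵀ * A⁻¹ * Cᵀ) b)),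
      lintegral_gaussPdf (posDef_schur h'), mul_one]
  · simp

lemma sunPdf_add_mulVec (hD : D.PosDef) (ξ w : ι → ℝ) (hw : ∀ i, 0 < w i) (γ : κ → ℝ)
    (z : ι → ℝ) :
    sunPdf ξ γ w A C D (ξ + diagonal w *ᵥ z) = |(diagonal w).det|⁻¹ *
      (gaussPdf 0 D z * gaussCdf (A - Cᵀ * D⁻¹ * C) (γ + Cᵀ *ᵥ D⁻¹ *ᵥ z) / gaussCdf A γ) := by
  have hdet : (diagonal w).det ≠ 0 := by
    simpa [Finset.prod_eq_zero_iff] using fun i => (hw i).ne'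
  have hz : (fun i => ((ξ + diagonal w *ᵥ z) i - ξ i) / w i) = z := by
    ext i
    simp [mulVec_diagonal, (hw i).ne']
  have hg := gaussPdf_congruence hD hdet z
  rw [diagonal_transpose] at hg
  rw [sunPdf, hz, add_sub_cancel_left, hg]
  ring

end GaussPdf

/-- **Density of the unified skew-normal distribution from its hidden-truncation
construction.**  If `U = (U₀, U₁) ~ N_{p+d}(0, Ω*)` with `Ω* = [[Γ, Δᵀ], [Δ, Ω̄]]` positive
definite and `Ω̄` a correlation matrix, then `Y = ξ + ωZ`, where `Z` is distributed as `U₁`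
conditioned on the componentwise event `{U₀ + γ > 0}` and `ω = diag(w)` with positive entries,
has density `f_Y(x) = φ_d(x − ξ; Ω) Φ_p(γ + ΔᵀΩ̄⁻¹ω⁻¹(x − ξ); Γ − ΔᵀΩ̄⁻¹Δ) / Φ_p(γ; Γ)`. -/
theorem stmt_11 {p d : ℕ} {Ω : Type*} [MeasurableSpace Ω]
    (μ : Measure Ω) [IsProbabilityMeasure μ]
    (γ : Fin p → ℝ) (Γ : Matrix (Fin p) (Fin p) ℝ) (Δ : Matrix (Fin d) (Fin p) ℝ)
    (Ωb : Matrix (Fin d) (Fin d) ℝ)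
    (hpd : (Matrix.fromBlocks Γ Δᵀ Δ Ωb).PosDef)
    (hcorr : ∀ i, Ωb i i = 1)
    (U : Ω → (Fin p ⊕ Fin d) → ℝ) (hU : Measurable U)
    (hlaw : Measure.map U μ = volume.withDensity fun x =>
      ENNReal.ofReal (gaussPdf 0 (Matrix.fromBlocks Γ Δᵀ Δ Ωb) x))
    (ξ : Fin d → ℝ) (w : Fin d → ℝ) (hw : ∀ i, 0 < w i) :
    Measure.map (fun ω i => ξ i + w i * U ω (Sum.inr i))
        (ProbabilityTheory.cond μ {ω | ∀ j, 0 < U ω (Sum.inl j) + γ j}) =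
      volume.withDensity fun x => ENNReal.ofReal (sunPdf ξ γ w Γ Δ Ωb x) := by
  have hD := posDef_of_fromBlocks_right hpd
  have hΓ : Γ.PosDef := posDef_of_fromBlocks_right (posDef_fromBlocks_swap hpd)
  have hdet : (diagonal w).det ≠ 0 := by
    simpa [Finset.prod_eq_zero_iff] using fun i => (hw i).ne'
  have hE : MeasurableSet {x : Fin p ⊕ Fin d → ℝ | ∀ j, 0 < x (Sum.inl j) + γ j} := by
    measurability
  have hf : Measurable fun z : Fin d → ℝ => ξ + diagonal w *ᵥ z := by fun_prop
  have hr : Measurable fun x : Fin p ⊕ Fin d → ℝ => x ∘ Sum.inr := by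
    unfold Function.comp; fun_prop
  have hY : (fun ω i => ξ i + w i * U ω (Sum.inr i)) =
      fun ω => ξ + diagonal w *ᵥ (U ω ∘ Sum.inr) := by
    ext ω i
    simp [mulVec_diagonal]
  have hEμ : μ {ω | ∀ j, 0 < U ω (Sum.inl j) + γ j} = ENNReal.ofReal (gaussCdf Γ γ) := by
    rw [← setLIntegral_gaussPdf_fromBlocks_left hpd, ← withDensity_apply _ hE, ← hlaw,
      Measure.map_apply hU hE]
    rfl
  ext s hs
  have hT : MeasurableSet {z : Fin d → ℝ | ξ + diagonal w *ᵥ z ∈ s} := hf hs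
  have hjoint : μ ({ω | ∀ j, 0 < U ω (Sum.inl j) + γ j} ∩
      (fun ω => ξ + diagonal w *ᵥ (U ω ∘ Sum.inr)) ⁻¹' s) =
      ∫⁻ b in {z | ξ + diagonal w *ᵥ z ∈ s}, ENNReal.ofReal
        (gaussPdf 0 Ωb b * gaussCdf (Γ - Δᵀ * Ωb⁻¹ * Δ) (γ + Δᵀ *ᵥ Ωb⁻¹ *ᵥ b)) := by
    rw [← setLIntegral_gaussPdf_fromBlocks hpd γ hT]
    have hET := hE.inter (hr hT)
    exact (Measure.map_apply hU hET).symm.trans (by rw [hlaw, withDensity_apply _ hET]; rfl)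
  have hpos : 0 < |(diagonal w).det|⁻¹ := by positivity
  have hscale := lintegral_comp_mulVec hdet fun y => s.indicator
    (fun x => ENNReal.ofReal (sunPdf ξ γ w Γ Δ Ωb x)) (ξ + y)
  have hpt (z : Fin d → ℝ) : s.indicator (fun x => ENNReal.ofReal (sunPdf ξ γ w Γ Δ Ωb x))
      (ξ + diagonal w *ᵥ z) = ENNReal.ofReal |(diagonal w).det|⁻¹ *
        ((ENNReal.ofReal (gaussCdf Γ γ))⁻¹ * {z | ξ + diagonal w *ᵥ z ∈ s}.indicator
          (fun b => ENNReal.ofReal (gaussPdf 0 Ωb b *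
            gaussCdf (Γ - Δᵀ * Ωb⁻¹ * Δ) (γ + Δᵀ *ᵥ Ωb⁻¹ *ᵥ b))) z) := by
    by_cases hz : ξ + diagonal w *ᵥ z ∈ s
    · rw [Set.indicator_of_mem hz, Set.indicator_of_mem (by exact hz),
        sunPdf_add_mulVec hD ξ w hw, ENNReal.ofReal_mul hpos.le,
        ENNReal.ofReal_div_of_pos (gaussCdf_pos hΓ γ), ENNReal.div_eq_inv_mul]
    · simp [hz]
  have hne : (ENNReal.ofReal (gaussCdf Γ γ))⁻¹ ≠ ⊤ := by simpa using gaussCdf_pos hΓ γ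
  simp_rw [hpt] at hscale
  rw [lintegral_const_mul' _ _ ENNReal.ofReal_ne_top, lintegral_const_mul' _ _ hne,
    lintegral_indicator hT, lintegral_add_left_eq_self (fun x => s.indicator
      (fun x => ENNReal.ofReal (sunPdf ξ γ w Γ Δ Ωb x)) x) ξ, lintegral_indicator hs] at hscale
  rw [hY, Measure.map_apply (by exact hf.comp (hr.comp hU)) hs, cond_apply (by exact hU hE),
    hEμ, hjoint, withDensity_apply _ hs]
  exact (ENNReal.mul_right_inj (by simpa using hdet) ENNReal.ofReal_ne_top).mp hscale
end
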